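/- Let G = D₄ (dihedral group of order 8) and let α^p be the 3-cocycle on D₄ given by the dihedral cocycle formula with m = 4, for p ∈ {0,1,…,7}. Let K = {(0,a) : a ∈ Z₄} ≅ Z₄ be the rotation subgroup. Then there exists a 2-cochain β: K×K → U(1) satisfying the Frobenius condition with respect to α^p if and only if p ≡ 0 (mod 4); moreover, when p ≡ 0 (mod 4) the restriction of α^p to K is identically 1, so β ≡ 1 is a solution. -/

import Mathlib

noncomputable section

/-- `α : G×G×G → U(1)` is a 3-cocycle. -/
def IsCocycle3 {G : Type*} [Group G] (α : G → G → G → Circle) : Prop :=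
  ∀ g0 g1 g2 g3 : G,
    α g1 g2 g3 * (α (g0 * g1) g2 g3)⁻¹ * α g0 (g1 * g2) g3 *
      (α g0 g1 (g2 * g3))⁻¹ * α g0 g1 g2 = 1

/-- `α` is a normalized 3-cochain. -/
def IsNormalized3 {G : Type*} [Group G] (α : G → G → G → Circle) : Prop :=
  ∀ g h : G, α 1 g h = 1 ∧ α g 1 h = 1 ∧ α g h 1 = 1

/-- `γ : K×K → U(1)` is a 2-cocycle. -/
def IsCocycle2 {K : Type*} [Group K] (γ : K → K → Circle) : Prop :=
  ∀ a b c : K, γ b c * (γ (a * b) c)⁻¹ * γ a (b * c) * (γ a b)⁻¹ = 1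

/-- The Frobenius condition on a 2-cochain `β` on the subgroup `K`, with respect to the
3-cocycle `α` on `G`:  `α(a,b,c)·β(b,c)·β(a,bc)·β(ab,c)⁻¹·β(a,b)⁻¹ = 1` for all `a,b,c ∈ K`. -/
def FrobeniusCondition {G : Type*} [Group G] (K : Subgroup G)
    (α : G → G → G → Circle) (β : K → K → Circle) : Prop :=
  ∀ a b c : K, α ↑a ↑b ↑c * β b c * β a (b * c) * (β (a * b) c)⁻¹ * (β a b)⁻¹ = 1

/-- The reflection degree: `0` on rotations `(0,a)` and `1` on reflections `(1,a)`. -/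
def reflDeg {m : ℕ} : DihedralGroup m → ℕ
  | .r _ => 0
  | .sr _ => 1

/-- The integer representative (in `{0,…,m-1}`) of the rotation part of a dihedral element. -/
def rotDeg {m : ℕ} : DihedralGroup m → ℤ
  | .r i => i.val
  | .sr i => i.val

/-- The dihedral 3-cocycle `α^p` on `D_m`:
`α^p((A,a),(B,b),(C,c)) = exp( (2πip/m²)·[ (−1)^{B+C}·ã·((−1)^C·b̃ + c̃ − [(−1)^C·b̃ + c̃]_m)
  + (m²/2)·Ã·B̃·C̃ ] )`. -/
noncomputable def dihedralCocycle (m : ℕ) (p : ℤ) (x y z : DihedralGroup m) : Circle :=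
  Circle.exp ((2 * Real.pi * (p : ℝ) / (m : ℝ) ^ 2) *
    ((-1 : ℝ) ^ (reflDeg y + reflDeg z) * (rotDeg x : ℝ) *
        (((((-1 : ℤ) ^ reflDeg z * rotDeg y + rotDeg z) -
          ((-1 : ℤ) ^ reflDeg z * rotDeg y + rotDeg z) % (m : ℤ)) : ℤ) : ℝ) +
      (m : ℝ) ^ 2 / 2 * (reflDeg x : ℝ) * (reflDeg y : ℝ) * (reflDeg z : ℝ)))

/-- The rotation subgroup `{(0,a) : a ∈ Z_m} ≅ Z_m` of the dihedral group `D_m`. -/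
def rotationSubgroup (m : ℕ) : Subgroup (DihedralGroup m) where
  carrier := {x | ∃ i, x = .r i}
  one_mem' := ⟨0, rfl⟩
  mul_mem' := by rintro _ _ ⟨i, rfl⟩ ⟨j, rfl⟩; exact ⟨i + j, by rw [DihedralGroup.r_mul_r]⟩
  inv_mem' := by rintro _ ⟨i, rfl⟩; exact ⟨-i, rfl⟩

/-- A solution `β` of the Frobenius condition makes `∏ j < n, α(g, g ^ j, g)` telescope to `1`
along the powers of an element `g` with `g ^ n = 1`. -/
theorem FrobeniusCondition.prod_pow_eq_one {G : Type*} [Group G] {K : Subgroup G}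
    {α : G → G → G → Circle} {β : K → K → Circle} (h : FrobeniusCondition K α β)
    (g : K) {n : ℕ} (hg : g ^ n = 1) :
    ∏ j ∈ Finset.range n, α g ((g ^ j : K) : G) g = 1 := by
  have step : ∀ j, α g ((g ^ j : K) : G) g =
      β (g ^ (j + 1)) g / β g (g ^ (j + 1)) / (β (g ^ j) g / β g (g ^ j)) := fun j => by
    have hj := h g (g ^ j) g
    rw [← pow_succ, ← pow_succ'] at hj
    rw [← mul_left_inj ((β (g ^ j) g) * β g (g ^ (j + 1)) * (β (g ^ (j + 1)) g)⁻¹ *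
      (β g (g ^ j))⁻¹), ← mul_assoc, ← mul_assoc, ← mul_assoc, hj]
    simp only [div_eq_mul_inv, mul_inv, inv_inv]
    have cancel (x y z w : Circle) : 1 = x * y⁻¹ * (z⁻¹ * w) * (z * y * x⁻¹ * w⁻¹) := by
      rw [show x * y⁻¹ * (z⁻¹ * w) * (z * y * x⁻¹ * w⁻¹) =
        (x * x⁻¹) * (y * y⁻¹) * (z * z⁻¹) * (w * w⁻¹) by ac_rfl]
      simp
    exact cancel ..
  rw [Finset.prod_congr rfl fun j _ => step j,
    Finset.prod_range_div fun j => β (g ^ j) g / β g (g ^ j), hg, pow_zero, div_self']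

theorem dihedralCocycle_r_r_r (m : ℕ) (p : ℤ) (i j k : ZMod m) :
    dihedralCocycle m p (.r i) (.r j) (.r k) =
      Circle.exp (2 * Real.pi * p / (m : ℝ) ^ 2 *
        ((i.val : ℝ) * (((j.val + k.val : ℤ) - (j.val + k.val : ℤ) % m : ℤ) : ℝ))) := by
  simp [dihedralCocycle, reflDeg, rotDeg]

/-- If `m ∣ p`, then `α^p` is trivial on rotations. -/
theorem dihedralCocycle_r_r_r_eq_one {m : ℕ} [NeZero m] {p : ℤ} (hp : (m : ℤ) ∣ p)
    (i j k : ZMod m) : dihedralCocycle m p (.r i) (.r j) (.r k) = 1 := by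
  obtain ⟨q, rfl⟩ := hp
  obtain ⟨t, ht⟩ : (m : ℤ) ∣ (j.val + k.val : ℤ) - (j.val + k.val : ℤ) % m :=
    Int.dvd_self_sub_emod
  have hm : (m : ℝ) ≠ 0 := NeZero.ne _
  rw [dihedralCocycle_r_r_r, ht, Circle.exp_eq_one]
  refine ⟨q * i.val * t, ?_⟩
  push_cast
  field_simp

/-- For `G = D₄`, `K` the rotation subgroup `Z₄`, and `p ∈ {0,…,7}`: the Frobenius
condition for `α^p` is solvable on `K` iff `p ≡ 0 (mod 4)`, in which case the restriction
of `α^p` to `K` is identically `1` and `β ≡ 1` is a solution. -/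
theorem d4_rotation_subgroup_boundary (p : ℤ) (hp : 0 ≤ p ∧ p ≤ 7) :
    ((∃ β : rotationSubgroup 4 → rotationSubgroup 4 → Circle,
        FrobeniusCondition (rotationSubgroup 4) (dihedralCocycle 4 p) β) ↔ p % 4 = 0) ∧
    (p % 4 = 0 →
      (∀ a b c : rotationSubgroup 4, dihedralCocycle 4 p ↑a ↑b ↑c = 1) ∧
      FrobeniusCondition (rotationSubgroup 4) (dihedralCocycle 4 p) fun _ _ => 1) := by
  have triv : p % 4 = 0 → ∀ a b c : rotationSubgroup 4, dihedralCocycle 4 p ↑a ↑b ↑c = 1 := by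
    rintro h4 ⟨_, i, rfl⟩ ⟨_, j, rfl⟩ ⟨_, k, rfl⟩
    exact dihedralCocycle_r_r_r_eq_one (Int.dvd_of_emod_eq_zero h4) i j k
  have frob : p % 4 = 0 →
      FrobeniusCondition (rotationSubgroup 4) (dihedralCocycle 4 p) fun _ _ => 1 :=
    fun h4 a b c => by simp [triv h4 a b c]
  refine ⟨⟨?_, fun h4 => ⟨_, frob h4⟩⟩, fun h4 => ⟨triv h4, frob h4⟩⟩
  rintro ⟨β, hβ⟩
  have hprod := hβ.prod_pow_eq_one ⟨.r 1, 1, rfl⟩ (n := 4) (Subtype.ext (by decide))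
  have val0 : (0 : ZMod 4).val = 0 := rfl
  have val1 : (1 : ZMod 4).val = 1 := rfl
  have val2 : (2 : ZMod 4).val = 2 := rfl
  have val3 : (3 : ZMod 4).val = 3 := rfl
  simp only [Finset.prod_range_succ, Finset.prod_range_zero, SubmonoidClass.coe_pow,
    DihedralGroup.r_one_pow, dihedralCocycle_r_r_r] at hprod
  norm_num [val0, val1, val2, val3] at hprod
  obtain ⟨n, hn⟩ := Circle.exp_eq_one.1 hprod
  have hpn : (p : ℝ) = 4 * n := by
    have := Real.pi_ne_zero
    field_simp at hn
    linarith
  have hpn' : p = 4 * n := by exact_mod_cast hpn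
  omega

end
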